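/- Fix integers r, g ≥ 1 and reals 0 < ε, δ < 1. There exist constants c₀, c > 0 depending only on r, g, ε, δ such that the following holds. Let Q₁, …, Q_r ∈ ℤ[X] be irreducible polynomials, pairwise coprime, such that Q := ∏_{j=1}^r Q_j has degree g, leading coefficient β, and no fixed prime divisor; let D be a nonzero integer divisible by every prime p modulo which Q has a repeated root or modulo which two of the Q_j share a common root. Let M = Σ_{j=1}^r M_j where M_j ≥ 1 satisfies |Σ_{p ≤ t} ρ_j(p)/p − log log t| ≤ M_j for all t ≥ 2. Then for all x ≥ c₀·‖Q‖^δ, x^ε < y ≤ x, and all reals y₁, …, y_r ≥ 2, there exist natural numbers k₁, …, k_r such that #{n ∈ ℤ : x < n ≤ x+y, ω_{y_j}(Q_j(n)) = k_j for all 1 ≤ j ≤ r} ≥ c · (φ(|βD|)/|βD|)^g · e^{−2M} · y / √(∏_{j=1}^r E_{ω_{y_j}}(x; ρ_j)). -/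

import Mathlib

open scoped Classical

/-- The finset of primes `p ≤ x` for a real `x`. -/
noncomputable def primesBelow (x : ℝ) : Finset ℕ :=
  (Finset.range (⌊x⌋₊ + 1)).filter Nat.Prime

/-- `ρ_Q(m) := #{0 ≤ n < m : m ∣ Q(n)}`. -/
noncomputable def rho (Q : Polynomial ℤ) (m : ℕ) : ℕ :=
  ((Finset.range m).filter fun n => (m : ℤ) ∣ Q.eval (n : ℤ)).card

/-- `‖Q‖` is the maximum of the absolute values of the coefficients of `Q`. -/
noncomputable def polyNorm (Q : Polynomial ℤ) : ℝ :=
  ((Q.support.sup fun i => (Q.coeff i).natAbs : ℕ) : ℝ)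

/-- `ω_y(n)` : number of distinct prime factors `p ≤ y` of `n`. -/
noncomputable def omegaY (y : ℝ) (n : ℕ) : ℕ :=
  (n.primeFactors.filter fun p => (p : ℝ) ≤ y).card

/-- `ω_y` extended to `ℤ` by `ω_y(−n) := ω_y(n)`, `ω_y(0) := 0`. -/
noncomputable def omegaYZ (y : ℝ) (n : ℤ) : ℕ := if n = 0 then 0 else omegaY y n.natAbs

/-- `E_f(x; ρ) := 1 + ∑_{p ≤ x, f(p) ≠ 0} ρ(p)/p` for `f = ω_y` and `ρ = ρ_Q`. -/
noncomputable def EomegaY (y x : ℝ) (Q : Polynomial ℤ) : ℝ :=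
  1 + ∑ p ∈ (primesBelow x).filter (fun p => omegaY y p ≠ 0), (rho Q p : ℝ) / p

lemma cnt_ap (a : ℤ) (N m : ℕ) (hm : 0 < m) (v : ℤ) :
    |(((Finset.Ioc a (a + N)).filter (fun n : ℤ => n ≡ v [ZMOD m])).card : ℝ) - (N : ℝ) / m| ≤ 1 := by
  have h := Int.Ioc_filter_modEq_card a (a + N) (r := (m : ℤ)) (by exact_mod_cast hm) v
  have h1 := Int.floor_le (((a + N : ℤ) - v : ℚ) / ((m : ℤ) : ℚ))
  have h2 := Int.lt_floor_add_one (((a + N : ℤ) - v : ℚ) / ((m : ℤ) : ℚ))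
  have h3 := Int.floor_le ((a - v : ℚ) / ((m : ℤ) : ℚ))
  have h4 := Int.lt_floor_add_one ((a - v : ℚ) / ((m : ℤ) : ℚ))
  set A := ⌊(((a + N : ℤ) - v : ℚ) / ((m : ℤ) : ℚ))⌋
  set B := ⌊((a - v : ℚ) / ((m : ℤ) : ℚ))⌋
  have hmq : (0 : ℚ) < m := by exact_mod_cast hm
  have e : ((((a + N : ℤ) : ℚ) - v) / ((m : ℤ) : ℚ)) = (a - v : ℚ) / ((m : ℤ) : ℚ) + (N : ℚ) / m := by
    push_cast; field_simp; ring
  rw [e] at h1 h2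
  have hN : (0 : ℚ) ≤ (N : ℚ) / m := by positivity
  set c := ((Finset.Ioc a (a + N)).filter (fun n : ℤ => n ≡ v [ZMOD m])).card
  have hq : |(c : ℚ) - (N : ℚ) / m| ≤ 1 := by
    have hAB : (B : ℚ) < A + 1 := by linarith
    have hAB' : B ≤ A := by
      have : B < A + 1 := by exact_mod_cast hAB
      omega
    rw [max_eq_left (by omega)] at h
    have hc : (c : ℚ) = (A : ℚ) - B := by exact_mod_cast h
    rw [hc, abs_le]
    constructor <;> linarith
  have hr := (Rat.cast_le (K := ℝ)).mpr hq
  push_cast at hr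
  exact hr

lemma var_bound (a : ℤ) (N : ℕ) (s : Finset (Σ _ : ℕ, ℕ))
    (hs : ∀ i ∈ s, i.1.Prime ∧ i.2 < i.1) :
    ∑ n ∈ Finset.Ioc a (a + N), ((∑ i ∈ s, if n ≡ i.2 [ZMOD i.1] then (1 : ℝ) else 0)
      - ∑ i ∈ s, (1 : ℝ) / i.1) ^ 2 ≤ N * (∑ i ∈ s, (1 : ℝ) / i.1) + 3 * (s.card : ℝ) ^ 2 := by
  set I := Finset.Ioc a (a + (N : ℤ)) with hI
  set f : (Σ _ : ℕ, ℕ) → ℤ → ℝ := fun i n => if n ≡ i.2 [ZMOD i.1] then (1 : ℝ) else 0 with hf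
  set A := ∑ i ∈ s, (1 : ℝ) / i.1 with hA
  have hIc : (I.card : ℝ) = N := by simp [hI]
  have hcnt : ∀ i ∈ s, |∑ n ∈ I, f i n - (N : ℝ) / i.1| ≤ 1 := by
    intro i hi
    have := cnt_ap a N i.1 (hs i hi).1.pos i.2
    simpa [hf, Finset.sum_boole] using this
  have hpair : ∀ i ∈ s, ∀ k ∈ s, ∑ n ∈ I, f i n * f k n ≤
      (N : ℝ) * (1 / i.1 * (1 / k.1)) + 1 + if i = k then (N : ℝ) * (1 / i.1) else 0 := by
    intro i hi k hk
    have hip := (hs i hi).1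
    have hkp := (hs k hk).1
    by_cases hik : i = k
    · subst hik
      have e : ∀ n, f i n * f i n = f i n := by intro n; simp [hf]
      simp only [e, if_true]
      have := (abs_le.mp (hcnt i hi)).2
      have h0 : (0:ℝ) ≤ (N : ℝ) * (1 / i.1 * (1 / i.1)) := by positivity
      have e2 : (N : ℝ) / i.1 = N * (1 / i.1) := by ring
      linarith
    · rw [if_neg hik]
      by_cases hp : i.1 = k.1
      · have h0 : ∑ n ∈ I, f i n * f k n = 0 := by
          apply Finset.sum_eq_zero
          intro n _
          simp only [hf]
          by_cases h1 : n ≡ i.2 [ZMOD i.1]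
          · by_cases h2 : n ≡ k.2 [ZMOD k.1]
            · exfalso
              apply hik
              rw [← hp] at h2
              have h3 : (i.2 : ℤ) ≡ k.2 [ZMOD i.1] := h1.symm.trans h2
              have h4 := (Int.natCast_modEq_iff).mp h3
              have h5 := Nat.ModEq.eq_of_lt_of_lt h4 (hs i hi).2 (hp ▸ (hs k hk).2)
              exact Sigma.ext hp (heq_of_eq h5)
            · simp [h2]
          · simp [h1]
        rw [h0]; positivity
      · have hco : Nat.Coprime i.1 k.1 := (Nat.coprime_primes hip hkp).mpr hp
        obtain ⟨v, hv1, hv2⟩ := Nat.chineseRemainder hco i.2 k.2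
        have hc := cnt_ap a N (i.1 * k.1) (Nat.mul_pos hip.pos hkp.pos) v
        have e : ∀ n, f i n * f k n = if n ≡ v [ZMOD ((i.1 * k.1 : ℕ) : ℤ)] then (1 : ℝ) else 0 := by
          intro n
          have : (n ≡ v [ZMOD ((i.1 * k.1 : ℕ) : ℤ)]) ↔ (n ≡ i.2 [ZMOD i.1] ∧ n ≡ k.2 [ZMOD k.1]) := by
            have h1 : (v : ℤ) ≡ i.2 [ZMOD i.1] := (Int.natCast_modEq_iff).mpr hv1
            have h2 : (v : ℤ) ≡ k.2 [ZMOD k.1] := (Int.natCast_modEq_iff).mpr hv2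
            push_cast
            rw [← Int.modEq_and_modEq_iff_modEq_mul (by simpa using hco)]
            constructor
            · rintro ⟨h3, h4⟩; exact ⟨h3.trans h1, h4.trans h2⟩
            · rintro ⟨h3, h4⟩; exact ⟨h3.trans h1.symm, h4.trans h2.symm⟩
          simp only [hf, this]
          by_cases h1 : n ≡ i.2 [ZMOD i.1] <;> by_cases h2 : n ≡ k.2 [ZMOD k.1] <;> simp [h1, h2]
        simp only [e, Finset.sum_boole]
        have := (abs_le.mp hc).2
        have e2 : (N : ℝ) / ((i.1 * k.1 : ℕ) : ℝ) = N * (1 / i.1 * (1 / k.1)) := by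
          push_cast; rw [one_div_mul_one_div]; ring
        rw [e2] at this
        linarith
  have hS2 : ∑ n ∈ I, (∑ i ∈ s, f i n) ^ 2 ≤ N * A ^ 2 + (s.card : ℝ) ^ 2 + N * A := by
    have e1 : ∑ n ∈ I, (∑ i ∈ s, f i n) ^ 2 = ∑ i ∈ s, ∑ k ∈ s, ∑ n ∈ I, f i n * f k n := by
      simp only [sq, Finset.sum_mul_sum]
      rw [Finset.sum_comm]
      refine Finset.sum_congr rfl fun i _ => ?_
      rw [Finset.sum_comm]
    rw [e1]
    calc _ ≤ ∑ i ∈ s, ∑ k ∈ s, ((N : ℝ) * (1 / i.1 * (1 / k.1)) + 1 + if i = k then (N : ℝ) * (1 / i.1) else 0) :=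
          Finset.sum_le_sum fun i hi => Finset.sum_le_sum fun k hk => hpair i hi k hk
      _ = _ := by
          simp only [Finset.sum_add_distrib, ← Finset.mul_sum, Finset.sum_ite_eq, Finset.sum_const]
          rw [← Finset.sum_mul]
          have : ∑ i ∈ s, (if i ∈ s then (N : ℝ) * (1 / (i.1 : ℝ)) else 0) = N * A := by
            rw [hA, Finset.mul_sum]
            exact Finset.sum_congr rfl fun i hi => if_pos hi
          rw [this]
          simp only [nsmul_eq_mul, mul_one]
          ring
  have hS1 : (N : ℝ) * A - s.card ≤ ∑ n ∈ I, ∑ i ∈ s, f i n := by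
    rw [Finset.sum_comm]
    have : ∑ i ∈ s, ((N : ℝ) * (1 / i.1) - 1) ≤ ∑ i ∈ s, ∑ n ∈ I, f i n := by
      refine Finset.sum_le_sum fun i hi => ?_
      have := (abs_le.mp (hcnt i hi)).1
      have e2 : (N : ℝ) / i.1 = N * (1 / i.1) := by ring
      linarith
    rw [Finset.sum_sub_distrib, ← Finset.mul_sum, ← hA, Finset.sum_const, nsmul_eq_mul, mul_one] at this
    exact this
  have hA0 : 0 ≤ A := Finset.sum_nonneg fun i _ => by positivity
  have hAL : A ≤ s.card := by
    have : A ≤ ∑ i ∈ s, (1 : ℝ) := by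
      refine Finset.sum_le_sum fun i hi => ?_
      have : (1 : ℝ) ≤ i.1 := by exact_mod_cast (hs i hi).1.one_le
      rw [div_le_one (by linarith)]; exact this
    simpa using this
  have e : ∑ n ∈ I, ((∑ i ∈ s, f i n) - A) ^ 2 =
      ∑ n ∈ I, (∑ i ∈ s, f i n) ^ 2 - 2 * A * ∑ n ∈ I, ∑ i ∈ s, f i n + N * A ^ 2 := by
    simp only [sub_sq, Finset.sum_add_distrib, Finset.sum_sub_distrib, Finset.sum_const, nsmul_eq_mul, hIc]
    rw [Finset.mul_sum]
    congr 2
    exact Finset.sum_congr rfl fun n _ => by ring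
  rw [e]
  nlinarith [mul_le_mul_of_nonneg_left hS1 hA0, mul_le_mul_of_nonneg_right hAL (Nat.cast_nonneg (α := ℝ) s.card)]

lemma rho_eq (Q : Polynomial ℤ) (m : ℕ) :
    rho Q m = ((Finset.range m).filter (fun k : ℕ => (m : ℤ) ∣ Q.eval (k : ℤ))).card := by
  have e : (do let a ← Finset.range m; pure ((a : ℕ) : ℤ) : Finset ℤ) =
      (Finset.range m).image (fun a : ℕ => (a : ℤ)) := by
    ext z
    simp
  unfold rho
  rw [e, Finset.filter_image, Finset.card_image_of_injective _ Nat.cast_injective]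

lemma omegaY_eq (y : ℝ) (n : ℕ) :
    omegaY y n = (n.primeFactors.filter fun p : ℕ => (p : ℝ) ≤ y).card := by
  have e : (do let a ← n.primeFactors; pure ((a : ℕ) : ℝ) : Finset ℝ) =
      n.primeFactors.image (fun a : ℕ => (a : ℝ)) := by
    ext z
    simp
  unfold omegaY
  rw [e, Finset.filter_image, Finset.card_image_of_injective _ Nat.cast_injective]

lemma dvd_eval_congr (P : Polynomial ℤ) (p : ℕ) (n m : ℤ) (h : n ≡ m [ZMOD p]) :
    (p : ℤ) ∣ P.eval n ↔ (p : ℤ) ∣ P.eval m := by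
  have h1 : (p : ℤ) ∣ P.eval n - P.eval m :=
    (Int.modEq_iff_dvd.mp h.symm).trans (P.sub_dvd_eval_sub n m)
  constructor
  · intro h2; have := dvd_sub h2 h1; simpa using this
  · intro h2; have := dvd_add h1 h2; simpa using this

lemma sum_ind (P : Polynomial ℤ) (p : ℕ) (hp : 0 < p) (n : ℤ) :
    (∑ k ∈ (Finset.range p).filter (fun k : ℕ => (p : ℤ) ∣ P.eval (k : ℤ)),
      if n ≡ (k : ℤ) [ZMOD p] then (1 : ℝ) else 0) = if (p : ℤ) ∣ P.eval n then 1 else 0 := by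
  have hp' : (0 : ℤ) < p := by exact_mod_cast hp
  have hk0 : (((n % p).toNat : ℕ) : ℤ) = n % p := Int.toNat_of_nonneg (Int.emod_nonneg _ hp'.ne')
  have hmod : n ≡ (((n % p).toNat : ℕ) : ℤ) [ZMOD p] := by rw [hk0]; exact (Int.mod_modEq n p).symm
  have hlt : (n % p).toNat < p := by
    have := Int.emod_lt_of_pos n hp'
    omega
  split_ifs with h
  · rw [Finset.sum_eq_single (n % p).toNat]
    · rw [if_pos hmod]
    · intro b hb hne
      rw [if_neg]
      intro hb2
      apply hne
      have h3 := (Int.natCast_modEq_iff).mp (hb2.symm.trans hmod)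
      exact Nat.ModEq.eq_of_lt_of_lt h3 (Finset.mem_range.mp (Finset.mem_filter.mp hb).1) hlt
    · intro hno
      exact absurd (Finset.mem_filter.mpr ⟨Finset.mem_range.mpr hlt, (dvd_eval_congr P p _ _ hmod).mp h⟩) hno
  · apply Finset.sum_eq_zero
    intro k hk
    rw [if_neg]
    intro h2
    exact h ((dvd_eval_congr P p _ _ h2).mpr (Finset.mem_filter.mp hk).2)

lemma tk (P : Polynomial ℤ) (a : ℤ) (N g : ℕ) (T : Finset ℕ) (hT : ∀ p ∈ T, p.Prime)
    (hrho : ∀ p ∈ T, rho P p ≤ g) (hTN : T.card ^ 2 ≤ N) :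
    ∑ n ∈ Finset.Ioc a (a + N), (((T.filter (fun p : ℕ => (p : ℤ) ∣ P.eval n)).card : ℝ)
      - ∑ p ∈ T, (rho P p : ℝ) / p) ^ 2 ≤ N * (∑ p ∈ T, (rho P p : ℝ) / p + 3 * (g : ℝ) ^ 2) := by
  set s : Finset (Σ _ : ℕ, ℕ) := T.sigma
    (fun p => (Finset.range p).filter (fun k : ℕ => (p : ℤ) ∣ P.eval (k : ℤ))) with hs
  have h := var_bound a N s (by
    intro i hi
    rw [hs, Finset.mem_sigma] at hi
    exact ⟨hT _ hi.1, Finset.mem_range.mp (Finset.mem_filter.mp hi.2).1⟩)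
  have hA : ∑ i ∈ s, (1 : ℝ) / i.1 = ∑ p ∈ T, (rho P p : ℝ) / p := by
    rw [hs, Finset.sum_sigma]
    refine Finset.sum_congr rfl fun p _ => ?_
    simp only [Finset.sum_const, nsmul_eq_mul, rho_eq]
    ring
  have hS : ∀ n : ℤ, (∑ i ∈ s, if n ≡ i.2 [ZMOD i.1] then (1 : ℝ) else 0) =
      ((T.filter (fun p : ℕ => (p : ℤ) ∣ P.eval n)).card : ℝ) := by
    intro n
    rw [hs, Finset.sum_sigma, ← Finset.sum_boole]
    exact Finset.sum_congr rfl fun p hp => sum_ind P p (hT p hp).pos n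
  simp only [hS, hA] at h
  refine h.trans ?_
  have hc : s.card ≤ T.card * g := by
    rw [hs, Finset.card_sigma]
    exact Finset.sum_le_card_nsmul _ _ _ (fun p hp => (rho_eq P p) ▸ hrho p hp)
  have hc2 : (s.card : ℝ) ≤ T.card * g := by exact_mod_cast hc
  have hc3 : (s.card : ℝ) ^ 2 ≤ (T.card * g : ℝ) ^ 2 := by gcongr
  have hTN' : (T.card : ℝ) ^ 2 ≤ N := by exact_mod_cast hTN
  have : (T.card : ℝ) ^ 2 * (g : ℝ) ^ 2 ≤ N * (g : ℝ) ^ 2 := by gcongr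
  rw [mul_pow] at hc3
  linarith

lemma cheb (I : Finset ℤ) (F : ℤ → ℝ) (V t : ℝ) (h : ∑ n ∈ I, (F n) ^ 2 ≤ V) :
    ((I.filter (fun n => t < (F n) ^ 2)).card : ℝ) * t ≤ V := by
  refine le_trans ?_ h
  calc _ = ∑ n ∈ I.filter (fun n => t < (F n) ^ 2), t := by simp
    _ ≤ ∑ n ∈ I.filter (fun n => t < (F n) ^ 2), (F n) ^ 2 :=
        Finset.sum_le_sum fun n hn => (Finset.mem_filter.mp hn).2.le
    _ ≤ _ := Finset.sum_le_sum_of_subset_of_nonneg (Finset.filter_subset _ _) fun _ _ _ => sq_nonneg _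

lemma rho_le_deg (P : Polynomial ℤ) (p : ℕ) (hp : p.Prime) (h : ∃ n : ℤ, ¬ (p : ℤ) ∣ P.eval n) :
    rho P p ≤ P.natDegree := by
  have := Fact.mk hp
  obtain ⟨n, hn⟩ := h
  set R := P.map (Int.castRingHom (ZMod p)) with hR
  have hev : ∀ m : ℤ, R.eval (m : ZMod p) = ((P.eval m : ℤ) : ZMod p) := by
    intro m
    rw [hR, Polynomial.eval_intCast_map]
    simp
  have hR0 : R ≠ 0 := by
    intro h0
    apply hn
    rw [← ZMod.intCast_zmod_eq_zero_iff_dvd, ← hev n, h0]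
    simp
  have h1 : rho P p ≤ R.roots.toFinset.card := by
    rw [rho_eq]
    apply Finset.card_le_card_of_injOn (fun k : ℕ => (k : ZMod p))
    · intro k hk
      have hk2 := (Finset.mem_filter.mp hk).2
      have : R.eval (((k : ℤ)) : ZMod p) = 0 := by
        rw [hev]; exact (ZMod.intCast_zmod_eq_zero_iff_dvd _ _).mpr hk2
      simp only [Finset.mem_coe, Multiset.mem_toFinset, Polynomial.mem_roots hR0, Polynomial.IsRoot.def]
      simpa using this
    · intro k hk l hl hkl
      have hk1 := Finset.mem_range.mp (Finset.mem_filter.mp hk).1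
      have hl1 := Finset.mem_range.mp (Finset.mem_filter.mp hl).1
      exact Nat.ModEq.eq_of_lt_of_lt ((ZMod.natCast_eq_natCast_iff _ _ _).mp hkl) hk1 hl1
  calc rho P p ≤ R.roots.toFinset.card := h1
    _ ≤ Multiset.card R.roots := Multiset.toFinset_card_le _
    _ ≤ R.natDegree := Polynomial.card_roots' _
    _ ≤ P.natDegree := Polynomial.natDegree_map_le

lemma large_primes (m : ℤ) (hm : m ≠ 0) (U : Finset ℕ) (w : ℝ) (hw : 0 ≤ w)
    (hU : ∀ p ∈ U, p.Prime ∧ p ∣ m.natAbs ∧ w ≤ p) : w ^ U.card ≤ |(m : ℝ)| := by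
  have h1 : ∏ p ∈ U, p ∣ m.natAbs :=
    Finset.prod_primes_dvd _ (fun p hp => (hU p hp).1.prime) (fun p hp => (hU p hp).2.1)
  have h2 : ∏ p ∈ U, p ≤ m.natAbs := Nat.le_of_dvd (Int.natAbs_pos.mpr hm) h1
  have h3 : w ^ U.card ≤ ∏ p ∈ U, (p : ℝ) := by
    rw [← Finset.prod_const]
    exact Finset.prod_le_prod (fun _ _ => hw) (fun p hp => (hU p hp).2.2)
  calc _ ≤ ∏ p ∈ U, (p : ℝ) := h3
    _ = ((∏ p ∈ U, p : ℕ) : ℝ) := by push_cast; rfl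
    _ ≤ (m.natAbs : ℝ) := Nat.cast_le.mpr h2
    _ = _ := by rw [Nat.cast_natAbs]; simp

lemma poly_bound (Q : Polynomial ℤ) (n : ℤ) (X : ℝ) (hX : 1 ≤ X) (hn : |(n : ℝ)| ≤ X) :
    |((Q.eval n : ℤ) : ℝ)| ≤ (Q.natDegree + 1) * polyNorm Q * X ^ Q.natDegree := by
  have hcoef : ∀ i, |((Q.coeff i : ℤ) : ℝ)| ≤ polyNorm Q := by
    intro i
    have e : |((Q.coeff i : ℤ) : ℝ)| = ((Q.coeff i).natAbs : ℝ) := by rw [Nat.cast_natAbs]; simp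
    rw [e]
    by_cases hi : i ∈ Q.support
    · unfold polyNorm
      exact_mod_cast Finset.le_sup (f := fun i => (Q.coeff i).natAbs) hi
    · rw [Polynomial.notMem_support_iff.mp hi]
      simp [polyNorm]
  rw [Polynomial.eval_eq_sum_range]
  push_cast
  refine (Finset.abs_sum_le_sum_abs _ _).trans ?_
  have : ∀ i ∈ Finset.range (Q.natDegree + 1),
      |((Q.coeff i : ℤ) : ℝ) * (n : ℝ) ^ i| ≤ polyNorm Q * X ^ Q.natDegree := by
    intro i hi
    rw [abs_mul, abs_pow]
    have h0 : 0 ≤ polyNorm Q := (abs_nonneg _).trans (hcoef 0)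
    have h1 : |(n : ℝ)| ^ i ≤ X ^ i := by gcongr
    have h2 : X ^ i ≤ X ^ Q.natDegree := pow_le_pow_right₀ hX (by have := Finset.mem_range.mp hi; omega)
    exact mul_le_mul (hcoef i) (h1.trans h2) (by positivity) h0
  refine (Finset.sum_le_card_nsmul _ _ _ this).trans ?_
  simp only [Finset.card_range, nsmul_eq_mul]
  push_cast
  linarith

noncomputable def Tset (N : ℕ) (y : ℝ) : Finset ℕ :=
  (Finset.Icc 1 N.sqrt).filter (fun p => p.Prime ∧ (p : ℝ) ≤ y)

lemma omega_split (m : ℤ) (hm : m ≠ 0) (y : ℝ) (N : ℕ) (w B : ℝ) (hw : 0 ≤ w)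
    (hwN : ∀ p : ℕ, N < p ^ 2 → w ≤ p) (hB : ∀ k : ℕ, w ^ k ≤ |(m : ℝ)| → (k : ℝ) ≤ B) :
    (((Tset N y).filter (fun p : ℕ => (p : ℤ) ∣ m)).card : ℝ) ≤ omegaYZ y m ∧
    (omegaYZ y m : ℝ) ≤ (((Tset N y).filter (fun p : ℕ => (p : ℤ) ∣ m)).card : ℝ) + B := by
  have e : omegaYZ y m = (m.natAbs.primeFactors.filter fun p : ℕ => (p : ℝ) ≤ y).card := by
    rw [omegaYZ, if_neg hm, omegaY_eq]
  set W := m.natAbs.primeFactors.filter fun p : ℕ => (p : ℝ) ≤ y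
  set Z := (Tset N y).filter (fun p : ℕ => (p : ℤ) ∣ m)
  have hsub : Z ⊆ W := by
    intro p hp
    simp only [Z, Tset, Finset.mem_filter] at hp
    simp only [W, Finset.mem_filter, Nat.mem_primeFactors]
    exact ⟨⟨hp.1.2.1, Int.natCast_dvd.mp hp.2, by simpa using hm⟩, hp.1.2.2⟩
  have hcard : (W \ Z).card + Z.card = W.card := Finset.card_sdiff_add_card_eq_card hsub
  have hl := large_primes m hm (W \ Z) w hw (by
    intro p hp
    simp only [W, Z, Tset, Finset.mem_sdiff, Finset.mem_filter, Nat.mem_primeFactors, Finset.mem_Icc] at hp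
    obtain ⟨⟨⟨h1, h2, h3⟩, h4⟩, h5⟩ := hp
    refine ⟨h1, h2, hwN p ?_⟩
    by_contra hlt
    apply h5
    refine ⟨⟨⟨h1.one_le, ?_⟩, h1, h4⟩, Int.natCast_dvd.mpr h2⟩
    rw [Nat.le_sqrt']
    omega)
  have hb := hB _ hl
  have hc : ((W \ Z).card : ℝ) + Z.card = W.card := by exact_mod_cast hcard
  rw [e]
  constructor
  · exact_mod_cast Finset.card_le_card hsub
  · linarith

lemma pigeon {r : ℕ} (G : Finset ℤ) (hG : G.Nonempty) (F : Fin r → ℤ → ℕ) (lo hi : Fin r → ℝ) (L : Fin r → ℝ)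
    (hF : ∀ n ∈ G, ∀ j, lo j ≤ F j n ∧ (F j n : ℝ) ≤ hi j) (hL : ∀ j, hi j - lo j + 1 ≤ L j) :
    ∃ k : Fin r → ℕ, (G.card : ℝ) ≤ (G.filter (fun n => ∀ j, F j n = k j)).card * ∏ j, L j := by
  set Bx : Finset (Fin r → ℕ) := Fintype.piFinset (fun j => Finset.Icc ⌈lo j⌉₊ ⌊hi j⌋₊) with hBx
  have hmap : ∀ n ∈ G, (fun j => F j n) ∈ Bx := by
    intro n hn
    rw [hBx, Fintype.mem_piFinset]
    intro j
    rw [Finset.mem_Icc]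
    exact ⟨Nat.ceil_le.mpr (hF n hn j).1, Nat.le_floor (hF n hn j).2⟩
  obtain ⟨n0, hn0⟩ := hG
  have hne : Bx.Nonempty := ⟨_, hmap n0 hn0⟩
  have hcard : (Bx.card : ℝ) ≤ ∏ j, L j := by
    rw [hBx, Fintype.card_piFinset]
    push_cast
    refine Finset.prod_le_prod (fun _ _ => by positivity) fun j _ => ?_
    refine le_trans ?_ (hL j)
    have h1 := hF n0 hn0 j
    have hhi : 0 ≤ hi j := le_trans (Nat.cast_nonneg _) h1.2
    have h2 := Nat.floor_le hhi
    have h3 := Nat.le_ceil (lo j)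
    have h4 : ⌈lo j⌉₊ ≤ ⌊hi j⌋₊ := (Nat.ceil_le.mpr h1.1).trans (Nat.le_floor h1.2)
    rw [Nat.card_Icc, Nat.cast_sub (by omega)]
    push_cast
    linarith
  obtain ⟨k, hk, hk2⟩ := Finset.exists_le_card_fiber_of_nsmul_le_card_of_maps_to
    (s := G) (t := Bx) (f := fun n j => F j n) (b := (G.card : ℝ) / Bx.card) hmap hne (by
      rw [nsmul_eq_mul]
      have : (0 : ℝ) < Bx.card := by exact_mod_cast hne.card_pos
      rw [mul_div_cancel₀ _ this.ne'])
  refine ⟨k, ?_⟩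
  have hpos : (0 : ℝ) < Bx.card := by exact_mod_cast hne.card_pos
  rw [div_le_iff₀ hpos] at hk2
  have e : (G.filter (fun n => (fun j => F j n) = k)) = G.filter (fun n => ∀ j, F j n = k j) := by
    apply Finset.filter_congr
    intro n _
    exact funext_iff
  rw [e] at hk2
  exact hk2.trans (by gcongr)

set_option maxHeartbeats 2000000 in
/-- Second part of Theorem 2 of the paper: the lower bound `(3)` for the functions
`ω_{y_j}`. Fix `r, g ≥ 1` and `0 < ε, δ < 1`. There exist `c₀, c > 0` depending only on
these parameters such that under the stated hypotheses, for all `y₁, …, y_r ≥ 2`, there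
are natural numbers `k₁, …, k_r` with
`#{x < n ≤ x+y : ω_{y_j}(Q_j(n)) = k_j ∀j} ≥
  c · (φ(|βD|)/|βD|)^g · e^{−2M} · y / √(∏_j E_{ω_{y_j}}(x; ρ_j))`. -/
theorem statement5 (r g : ℕ) (ε δ : ℝ)
    (hr : 1 ≤ r) (hg : 1 ≤ g)
    (hε : 0 < ε) (hε1 : ε < 1) (hδ : 0 < δ) (hδ1 : δ < 1) :
    ∃ c₀ c : ℝ, 0 < c₀ ∧ 0 < c ∧
      ∀ (Qs : Fin r → Polynomial ℤ) (D : ℤ) (Mj : Fin r → ℝ)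
        (x y : ℝ) (ys : Fin r → ℝ),
        (∀ j, Irreducible (Qs j)) →
        (∀ i j, i ≠ j → IsRelPrime (Qs i) (Qs j)) →
        (∏ j, Qs j).natDegree = g →
        (∀ p : ℕ, p.Prime → rho (∏ j, Qs j) p < p) →
        D ≠ 0 →
        (∀ p : ℕ, p.Prime →
          ((∃ n : ℤ, (p : ℤ) ∣ (∏ j, Qs j).eval n ∧
              (p : ℤ) ∣ (Polynomial.derivative (∏ j, Qs j)).eval n) ∨
           (∃ i j : Fin r, i ≠ j ∧ ∃ n : ℤ,
              (p : ℤ) ∣ (Qs i).eval n ∧ (p : ℤ) ∣ (Qs j).eval n)) →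
          (p : ℤ) ∣ D) →
        (∀ j, 1 ≤ Mj j) →
        (∀ j, ∀ t : ℝ, 2 ≤ t →
          |(∑ p ∈ primesBelow t, (rho (Qs j) p : ℝ) / p) - Real.log (Real.log t)| ≤ Mj j) →
        c₀ * polyNorm (∏ j, Qs j) ^ δ ≤ x → x ^ ε < y → y ≤ x →
        (∀ j, 2 ≤ ys j) →
        ∃ k : Fin r → ℕ,
          c * ((((∏ j, Qs j).leadingCoeff * D).natAbs.totient : ℝ) /
                (((∏ j, Qs j).leadingCoeff * D).natAbs : ℝ)) ^ g *
              Real.exp (-(2 * ∑ j, Mj j)) * y /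
              Real.sqrt (∏ j, EomegaY (ys j) x (Qs j)) ≤
            (({n : ℤ | x < (n : ℝ) ∧ (n : ℝ) ≤ x + y ∧
                ∀ j, omegaYZ (ys j) ((Qs j).eval n) = k j}).ncard : ℝ) := by
  set K : ℝ := Real.sqrt (12 * (g : ℝ) ^ 2 * r) with hK
  set B : ℝ := (2 * g + 1 / δ) * (4 / ε) with hBdef
  have hrR : (1 : ℝ) ≤ r := by exact_mod_cast hr
  have hgR : (1 : ℝ) ≤ g := by exact_mod_cast hg
  have hK0 : 0 ≤ K := Real.sqrt_nonneg _
  have hK2 : K ^ 2 = 12 * (g : ℝ) ^ 2 * r := Real.sq_sqrt (by positivity)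
  have hB0 : 0 ≤ B := by positivity
  set K' : ℝ := 2 * K + B + 1 with hK'
  have hK'0 : 0 < K' := by positivity
  set Y0 : ℝ := 8 * (g + 1) with hY0
  have hY016 : 16 ≤ Y0 := by rw [hY0]; linarith
  refine ⟨Y0 ^ (1 / ε), 1 / (4 * K' ^ r), by positivity, by positivity, ?_⟩
  intro Qs D Mj x y ys hirr _ hdeg hfix hD _ hM _ hx hyl hyx hys
  set Q := ∏ j, Qs j with hQ
  have hQ0 : Q ≠ 0 := by
    intro h0; rw [h0] at hdeg; simp at hdeg; omega
  -- sizes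
  have hn1 : 1 ≤ polyNorm Q := by
    have hmem : Q.natDegree ∈ Q.support := Polynomial.natDegree_mem_support_of_nonzero hQ0
    have h1 : 1 ≤ (Q.coeff Q.natDegree).natAbs :=
      Nat.one_le_iff_ne_zero.mpr (by simpa using hQ0)
    have h2 := Finset.le_sup (f := fun i => (Q.coeff i).natAbs) hmem
    unfold polyNorm
    exact_mod_cast h1.trans h2
  have hnd : 1 ≤ polyNorm Q ^ δ := Real.one_le_rpow hn1 hδ.le
  have hc1 : Y0 ≤ Y0 ^ (1 / ε) := by
    have : Y0 ^ (1 : ℝ) ≤ Y0 ^ (1 / ε) :=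
      Real.rpow_le_rpow_of_exponent_le (by linarith) (by rw [le_div_iff₀ hε]; linarith)
    simpa using this
  have hxc : Y0 ^ (1 / ε) ≤ x := by nlinarith
  have hx16 : 16 ≤ x := by linarith
  have hnx : polyNorm Q ≤ x ^ (1 / δ) := by
    have h1 : polyNorm Q ^ δ ≤ x := by nlinarith
    calc polyNorm Q = (polyNorm Q ^ δ) ^ (1 / δ) := by
          rw [← Real.rpow_mul (by linarith), mul_one_div_cancel hδ.ne', Real.rpow_one]
      _ ≤ x ^ (1 / δ) := Real.rpow_le_rpow (by linarith) h1 (by positivity)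
  have hyY : Y0 < y := by
    have : Y0 ≤ x ^ ε := by
      calc Y0 = (Y0 ^ (1 / ε)) ^ ε := by
            rw [← Real.rpow_mul (by linarith), one_div_mul_cancel hε.ne', Real.rpow_one]
        _ ≤ x ^ ε := Real.rpow_le_rpow (by positivity) hxc hε.le
    linarith
  -- the interval
  set a : ℤ := ⌊x⌋ with ha
  set N : ℕ := (⌊x + y⌋ - ⌊x⌋).toNat with hN
  have hle : ⌊x⌋ ≤ ⌊x + y⌋ := Int.floor_le_floor (by linarith)
  have hNz : (N : ℤ) = ⌊x + y⌋ - ⌊x⌋ := Int.toNat_of_nonneg (by omega)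
  have hNr : (N : ℝ) = (⌊x + y⌋ : ℝ) - ⌊x⌋ := by exact_mod_cast hNz
  have hNlo : y - 1 ≤ N := by
    have := Int.lt_floor_add_one (x + y); have := Int.floor_le x; linarith
  have hNhi : (N : ℝ) ≤ y + 1 := by
    have := Int.floor_le (x + y); have := Int.lt_floor_add_one x; linarith
  set I := Finset.Ioc a (a + (N : ℤ)) with hI
  have hIc : I.card = N := by simp [hI]
  have hmemI : ∀ n : ℤ, n ∈ I ↔ (x < n ∧ (n : ℝ) ≤ x + y) := by
    intro n
    rw [hI, Finset.mem_Ioc, hNz, ha, Int.floor_lt]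
    have : ⌊x⌋ + (⌊x + y⌋ - ⌊x⌋) = ⌊x + y⌋ := by ring
    rw [this, Int.le_floor]
  -- polynomials
  have hdvd : ∀ j, Qs j ∣ Q := fun j => Finset.dvd_prod_of_mem _ (Finset.mem_univ j)
  have hrho : ∀ j, ∀ p : ℕ, p.Prime → rho (Qs j) p ≤ g := by
    intro j p hp
    have h1 : ∃ n : ℤ, ¬ (p : ℤ) ∣ (Qs j).eval n := by
      by_contra hcon
      push Not at hcon
      have h2 := hfix p hp
      rw [rho_eq, Finset.filter_true_of_mem, Finset.card_range] at h2
      · exact lt_irrefl _ h2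
      · intro k _
        exact (hcon k).trans (Polynomial.eval_dvd (hdvd j))
    refine (rho_le_deg _ p hp h1).trans ?_
    rw [← hdeg]
    exact Polynomial.natDegree_le_of_dvd (hdvd j) hQ0
  set A : Fin r → ℝ := fun j => ∑ p ∈ Tset N (ys j), (rho (Qs j) p : ℝ) / p with hA
  set E : Fin r → ℝ := fun j => EomegaY (ys j) x (Qs j) with hE
  have hA0 : ∀ j, 0 ≤ A j := fun j => Finset.sum_nonneg fun p _ => by positivity
  have hAE : ∀ j, 1 + A j ≤ E j := by
    intro j
    simp only [hA, hE, EomegaY]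
    gcongr
    · intro p hp
      simp only [Tset, Finset.mem_filter, Finset.mem_Icc, Nat.le_sqrt'] at hp
      obtain ⟨⟨h1, h2⟩, h3, h4⟩ := hp
      have h5 : (p : ℝ) ^ 2 ≤ N := by exact_mod_cast h2
      have h6 : (2 : ℝ) ≤ p := by exact_mod_cast h3.two_le
      have h7 : (p : ℝ) ≤ x := by nlinarith
      have h8 : p ∈ p.primeFactors.filter (fun q : ℕ => (q : ℝ) ≤ ys j) := by
        simp [h3, h3.ne_zero, h4]
      simp only [primesBelow, Finset.mem_filter, Finset.mem_range]
      refine ⟨⟨Nat.lt_succ_of_le (Nat.le_floor h7), h3⟩, ?_⟩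
      rw [omegaY_eq]
      exact (Finset.card_pos.mpr ⟨p, h8⟩).ne'
  have hE1 : ∀ j, 1 ≤ E j := fun j => by linarith [hA0 j, hAE j]
  set S : Fin r → ℤ → ℝ := fun j n =>
    (((Tset N (ys j)).filter (fun p : ℕ => (p : ℤ) ∣ (Qs j).eval n)).card : ℝ) with hS
  set bad : Fin r → Finset ℤ := fun j => I.filter (fun n => K ^ 2 * E j < (S j n - A j) ^ 2) with hbad
  have hbadc : ∀ j, ((bad j).card : ℝ) * (4 * r) ≤ N := by
    intro j
    have h1 := tk (Qs j) a N g (Tset N (ys j)) (fun p hp => (Finset.mem_filter.mp hp).2.1)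
      (fun p hp => hrho j p (Finset.mem_filter.mp hp).2.1) (by
        have : (Tset N (ys j)).card ≤ N.sqrt := by
          refine (Finset.card_filter_le _ _).trans ?_
          simp
        calc _ ≤ N.sqrt ^ 2 := Nat.pow_le_pow_left this 2
          _ ≤ N := Nat.sqrt_le' N)
    have h2 := cheb I (fun n => S j n - A j) _ (K ^ 2 * E j) h1
    change ((bad j).card : ℝ) * (K ^ 2 * E j) ≤ N * (A j + 3 * (g : ℝ) ^ 2) at h2
    have hEj := hE1 j
    have h3 : A j + 3 * (g : ℝ) ^ 2 ≤ 3 * (g : ℝ) ^ 2 * E j := by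
      have := hAE j; have := hA0 j
      nlinarith [mul_le_mul_of_nonneg_left (hAE j) (by positivity : (0:ℝ) ≤ 3 * (g : ℝ) ^ 2),
        mul_nonneg (hA0 j) (by nlinarith : (0:ℝ) ≤ 3 * (g : ℝ) ^ 2 - 1)]
    have h4 : ((bad j).card : ℝ) * (K ^ 2 * E j) ≤ N * (3 * (g : ℝ) ^ 2 * E j) :=
      h2.trans (by gcongr)
    rw [hK2] at h4
    have h5 : (0 : ℝ) < 3 * (g : ℝ) ^ 2 * E j := by positivity
    refine le_of_mul_le_mul_right ?_ h5
    linarith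
  set zer : Finset ℤ := I.filter (fun n => Q.eval n = 0) with hzer
  have hzc : zer.card ≤ g := by
    calc zer.card ≤ Q.roots.toFinset.card := by
          apply Finset.card_le_card
          intro n hn
          have := (Finset.mem_filter.mp hn).2
          simpa [hQ0] using this
      _ ≤ Multiset.card Q.roots := Multiset.toFinset_card_le _
      _ ≤ g := hdeg ▸ Polynomial.card_roots' _
  set G : Finset ℤ := I \ (zer ∪ Finset.univ.biUnion bad) with hG
  have hGc : y / 4 ≤ (G.card : ℝ) := by
    have h1 : I.card ≤ G.card + (zer ∪ Finset.univ.biUnion bad).card := by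
      refine le_trans (Finset.card_le_card ?_) (Finset.card_union_le _ _)
      intro n hn
      by_cases h : n ∈ zer ∪ Finset.univ.biUnion bad
      · exact Finset.mem_union_right _ h
      · exact Finset.mem_union_left _ (Finset.mem_sdiff.mpr ⟨hn, h⟩)
    have h2 : (zer ∪ Finset.univ.biUnion bad).card ≤ g + ∑ j, (bad j).card :=
      (Finset.card_union_le _ _).trans (Nat.add_le_add hzc Finset.card_biUnion_le)
    have h3 : (N : ℝ) ≤ G.card + (g + ∑ j, ((bad j).card : ℝ)) := by
      rw [hIc] at h1
      exact_mod_cast h1.trans (by omega)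
    have h4 : ∑ j, ((bad j).card : ℝ) ≤ ∑ j : Fin r, (N : ℝ) / (4 * r) :=
      Finset.sum_le_sum fun j _ => by
        rw [le_div_iff₀ (by positivity)]; exact hbadc j
    have h5 : ∑ j : Fin r, (N : ℝ) / (4 * r) = N / 4 := by
      simp only [Finset.sum_const, Finset.card_univ, Fintype.card_fin, nsmul_eq_mul]
      field_simp
    rw [hY0] at hyY
    linarith
  have hGne : G.Nonempty := by
    rw [← Finset.card_pos]
    have : (0 : ℝ) < G.card := by linarith
    exact_mod_cast this
  -- values on G
  have hval : ∀ n ∈ G, ∀ j, A j - K * Real.sqrt (E j) ≤ omegaYZ (ys j) ((Qs j).eval n) ∧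
      (omegaYZ (ys j) ((Qs j).eval n) : ℝ) ≤ A j + K * Real.sqrt (E j) + B := by
    intro n hn j
    rw [hG, Finset.mem_sdiff, Finset.mem_union, not_or] at hn
    obtain ⟨hnI, hnz, hnb⟩ := hn
    have hQn : Q.eval n ≠ 0 := fun h => hnz (Finset.mem_filter.mpr ⟨hnI, h⟩)
    have hjn : (Qs j).eval n ≠ 0 := by
      intro h
      exact hQn (zero_dvd_iff.mp (h ▸ Polynomial.eval_dvd (hdvd j)))
    have hnj : (S j n - A j) ^ 2 ≤ K ^ 2 * E j := by
      by_contra hcon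
      exact hnb (Finset.mem_biUnion.mpr ⟨j, Finset.mem_univ j,
        Finset.mem_filter.mpr ⟨hnI, not_le.mp hcon⟩⟩)
    have habs : |S j n - A j| ≤ K * Real.sqrt (E j) := by
      apply abs_le_of_sq_le_sq _ (by positivity)
      rw [mul_pow, Real.sq_sqrt (x := E j) (by linarith [hE1 j])]
      exact hnj
    obtain ⟨hx1, hx2⟩ := (hmemI n).mp hnI
    have hx0 : (0 : ℝ) < x := by linarith
    have hbound : |(((Qs j).eval n : ℤ) : ℝ)| ≤ x ^ (2 * g + 1 / δ : ℝ) := by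
      have h1 : |(((Qs j).eval n : ℤ) : ℝ)| ≤ |((Q.eval n : ℤ) : ℝ)| := by
        have h2 := Int.le_of_dvd (abs_pos.mpr hQn)
          ((abs_dvd_abs _ _).mpr (Polynomial.eval_dvd (x := n) (hdvd j)))
        exact_mod_cast h2
      have h2 := poly_bound Q n (2 * x) (by linarith) (by
        rw [abs_of_pos (by linarith)]; linarith)
      rw [hdeg] at h2
      have h3 : ((g : ℝ) + 1) * 2 ^ g ≤ x ^ g := by
        have h4 : (g : ℝ) + 1 ≤ 2 ^ g := by exact_mod_cast (Nat.lt_two_pow_self (n := g))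
        calc ((g : ℝ) + 1) * 2 ^ g ≤ 2 ^ g * 2 ^ g := by gcongr
          _ = 4 ^ g := by rw [← mul_pow]; norm_num
          _ ≤ x ^ g := by gcongr; linarith
      calc _ ≤ _ := h1
        _ ≤ _ := h2
        _ = (((g : ℝ) + 1) * 2 ^ g) * x ^ g * polyNorm Q := by rw [mul_pow]; ring
        _ ≤ x ^ g * x ^ g * x ^ (1 / δ) := by gcongr
        _ = _ := by
          rw [Real.rpow_add hx0, two_mul, Real.rpow_add hx0, Real.rpow_natCast]
    have hsp := omega_split ((Qs j).eval n) hjn (ys j) N (x ^ (ε / 4)) B (by positivity)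
      (by
        intro p hp
        have h1 : (N : ℝ) < (p : ℝ) ^ 2 := by exact_mod_cast hp
        have h2 : (N : ℝ) + 1 ≤ (p : ℝ) ^ 2 := by exact_mod_cast hp
        have h3 : (x ^ (ε / 4)) ^ 4 = x ^ ε := by
          rw [← Real.rpow_mul_natCast hx0.le]; congr 1; push_cast; ring
        have h4 : 1 ≤ x ^ (ε / 4) := Real.one_le_rpow (by linarith) (by positivity)
        by_contra hlt
        push Not at hlt
        have h5 : (p : ℝ) ^ 2 < (x ^ (ε / 4)) ^ 2 := by gcongr
        have h6 : (x ^ (ε / 4)) ^ 2 ≤ (x ^ (ε / 4)) ^ 4 := pow_le_pow_right₀ h4 (by norm_num)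
        linarith)
      (by
        intro k hk
        have h1 : x ^ (ε / 4 * k) ≤ x ^ (2 * g + 1 / δ : ℝ) := by
          rw [Real.rpow_mul_natCast hx0.le]; exact hk.trans hbound
        rw [Real.rpow_le_rpow_left_iff (by linarith)] at h1
        rw [hBdef]
        have h2 : (k : ℝ) = (ε / 4 * k) * (4 / ε) := by field_simp
        rw [h2]
        gcongr)
    change S j n ≤ _ ∧ _ ≤ S j n + B at hsp
    have h1 := abs_le.mp habs
    constructor <;> linarith [hsp.1, hsp.2, h1.1, h1.2]
  obtain ⟨k, hk⟩ := pigeon G hGne (fun j n => omegaYZ (ys j) ((Qs j).eval n))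
    (fun j => A j - K * Real.sqrt (E j)) (fun j => A j + K * Real.sqrt (E j) + B)
    (fun j => K' * Real.sqrt (E j)) hval (by
      intro j
      have : 1 ≤ Real.sqrt (E j) := Real.one_le_sqrt.mpr (hE1 j)
      rw [hK']
      nlinarith)
  refine ⟨k, ?_⟩
  have hsub : ((G.filter (fun n => ∀ j, omegaYZ (ys j) ((Qs j).eval n) = k j)).card : ℝ) ≤
      (({n : ℤ | x < (n : ℝ) ∧ (n : ℝ) ≤ x + y ∧
                ∀ j, omegaYZ (ys j) ((Qs j).eval n) = k j}).ncard : ℝ) := by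
    rw [← Set.ncard_coe_finset]
    have hfin : ({n : ℤ | x < (n : ℝ) ∧ (n : ℝ) ≤ x + y ∧
                ∀ j, omegaYZ (ys j) ((Qs j).eval n) = k j}).Finite := by
      refine I.finite_toSet.subset ?_
      intro n hn
      exact (hmemI n).mpr ⟨hn.1, hn.2.1⟩
    refine Nat.cast_le.mpr (Set.ncard_le_ncard ?_ hfin)
    intro n hn
    have hn' := Finset.mem_filter.mp (Finset.mem_coe.mp hn)
    have hnI := (hmemI n).mp (Finset.mem_sdiff.mp hn'.1).1
    exact ⟨hnI.1, hnI.2, hn'.2⟩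
  refine le_trans ?_ hsub
  have hsq : Real.sqrt (∏ j, E j) = ∏ j, Real.sqrt (E j) := by
    simp only [Real.sqrt_eq_rpow]
    exact (Real.finsetProd_rpow _ _ (fun j _ => by linarith [hE1 j]) _).symm
  have hsp : 0 < Real.sqrt (∏ j, E j) :=
    Real.sqrt_pos.mpr (Finset.prod_pos fun j _ => by linarith [hE1 j])
  rw [Finset.prod_mul_distrib, ← hsq, Finset.prod_const, Finset.card_univ, Fintype.card_fin] at hk
  change _ / Real.sqrt (∏ j, E j) ≤ _
  rw [div_le_iff₀ hsp]
  have hphi : ((((Q.leadingCoeff * D).natAbs.totient : ℝ) /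
                ((Q.leadingCoeff * D).natAbs : ℝ))) ^ g ≤ 1 := by
    apply pow_le_one₀ (by positivity)
    apply div_le_one_of_le₀ _ (by positivity)
    exact_mod_cast Nat.totient_le _
  have hexp : Real.exp (-(2 * ∑ j, Mj j)) ≤ 1 := by
    rw [Real.exp_le_one_iff]
    have : 0 ≤ ∑ j, Mj j := Finset.sum_nonneg fun j _ => by linarith [hM j]
    linarith
  have hy0 : 0 < y := by linarith
  have hKr : 0 < K' ^ r := by positivity
  calc _ ≤ 1 / (4 * K' ^ r) * 1 * 1 * y := by gcongr
    _ = (y / 4) / K' ^ r := by field_simp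
    _ ≤ _ := by
      rw [div_le_iff₀ hKr]
      linarith
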